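/- With the generic frequency-domain parameterisation of an acyclic process graph G = (V, D) whose vertex set is partitioned as V = O ⊔ L with every l ∈ L having no incoming edge, let v ∈ O and suppose the triple (Y, W, L') with Y, W ⊆ O∖{v} and L' ⊆ L satisfies the latent-factor half-trek criterion with respect to v. Let K_S ⊆ 𝕂 be the smallest subfield of 𝕂 containing all rational functions of z alone (the image of ℝ(z) in 𝕂) together with all spectrum entries S_{o,o'} for o, o' ∈ O. If for every y ∈ W ∪ (Y ∩ htr_{L'}(W ∪ {v})) and every u ∈ O with (u,y) ∈ D the link function H_{u,y} belongs to K_S, then for every x ∈ O with (x,v) ∈ D the link function H_{x,v} belongs to K_S. -/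

import Mathlib

open Matrix
open scoped BigOperators

/-- A directed path in the graph with edge relation `E`: a nonempty list of vertices in
which consecutive vertices are joined by edges. A one-element list is the empty path at
that vertex. -/
structure DiPath {V : Type*} (E : V → V → Prop) where
  verts : List V
  ne : verts ≠ []
  chain : verts.Chain' E

namespace DiPath

variable {V : Type*} {E : V → V → Prop}

/-- The starting point of a directed path. -/
def first (p : DiPath E) : V := p.verts.head p.ne

/-- The endpoint of a directed path. -/
def last (p : DiPath E) : V := p.verts.getLast p.ne

/-- The list of edges traversed by a directed path. -/
def edges (p : DiPath E) : List (V × V) := p.verts.zip p.verts.tail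

/-- The weight of a directed path: the product of the matrix entries `H_{u,u'}` over all
its edges (an empty path has weight `1`). -/
def weight {K : Type*} [CommRing K] (H : Matrix V V K) (p : DiPath E) : K :=
  (p.edges.map fun e => H e.1 e.2).prod

end DiPath

/-- A system of non-intersecting directed paths from the enumerated set
`X = {x 0, …, x (r-1)}` to `Y = {y 0, …, y (r-1)}`: paths with pairwise disjoint vertex
sets, the `i`-th path going from `x i` to `y (perm i)`. -/
structure PathSystem {V : Type*} (E : V → V → Prop) (r : ℕ) (x y : Fin r → V) where
  path : Fin r → DiPath E
  perm : Equiv.Perm (Fin r)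
  first_eq : ∀ i, (path i).first = x i
  last_eq : ∀ i, (path i).last = y (perm i)
  disjoint : ∀ i j, i ≠ j → ∀ v ∈ (path i).verts, v ∉ (path j).verts

/-- The indeterminates of the generic parameterisation: `φ_{v,w,k}`, `ω_v` and `z`. -/
inductive GVar (V : Type u) : Type u
  | phi (v w : V) (k : ℕ)
  | omega (v : V)
  | z

/-- The field `𝕂 = ℝ(Φ, Ω, z)`: the field of fractions of the real polynomial ring in all
the indeterminates `φ_{v,w,k}`, `ω_v` and `z`. -/
abbrev GField (V : Type u) : Type u := FractionRing (MvPolynomial (GVar V) ℝ)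

/-- The image of an indeterminate in `𝕂`. -/
noncomputable def gv {V : Type*} (i : GVar V) : GField V :=
  algebraMap (MvPolynomial (GVar V) ℝ) (GField V) (MvPolynomial.X i)

/-- The image of a real constant in `𝕂`. -/
noncomputable def gconst {V : Type*} (a : ℝ) : GField V :=
  algebraMap (MvPolynomial (GVar V) ℝ) (GField V) (MvPolynomial.C a)

/-- The generic lag polynomial `φ_{v,w}(z) = Σ_{k ∈ K(v,w)} φ_{v,w,k}·z^k` in `𝕂`. -/
noncomputable def lagPoly {V : Type*} (Kf : V × V → Finset ℕ) (v w : V) : GField V :=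
  ∑ k ∈ Kf (v, w), gv (GVar.phi v w k) * gv GVar.z ^ k

/-- The generic direct transfer matrix `H` with `H_{v,w} = φ_{v,w}(z)/(1 − φ_{w,w}(z))` on
edges and `0` elsewhere. -/
noncomputable def Hmat {V : Type*} [DecidableEq V] (DO : Finset (V × V))
    (Kf : V × V → Finset ℕ) : Matrix V V (GField V) :=
  fun v w => if (v, w) ∈ DO then lagPoly Kf v w / (1 - lagPoly Kf w w) else 0

/-- The generic internal spectrum: the diagonal matrix with entries
`ω_v/((1 − φ_{v,v}(z))·σ(1 − φ_{v,v}(z)))`. -/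
noncomputable def SImat {V : Type*} [DecidableEq V] (Kf : V × V → Finset ℕ)
    (σ : GField V ≃+* GField V) : Matrix V V (GField V) :=
  Matrix.diagonal fun v =>
    gv (GVar.omega v) / ((1 - lagPoly Kf v v) * σ (1 - lagPoly Kf v v))

/-- The generic spectrum `S = ((I − H)ᵀ)⁻¹ · S^I · (I − H*)⁻¹`, where `H*` applies `σ`
entrywise to `H`. -/
noncomputable def Smat {V : Type*} [Fintype V] [DecidableEq V] (DO : Finset (V × V))
    (Kf : V × V → Finset ℕ) (σ : GField V ≃+* GField V) : Matrix V V (GField V) :=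
  ((1 - Hmat DO Kf)ᵀ)⁻¹ * SImat Kf σ * (1 - (Hmat DO Kf).map σ)⁻¹

/-- A trek: a pair of directed paths with a common starting vertex (the top). -/
structure Trek {V : Type*} (E : V → V → Prop) where
  left : DiPath E
  right : DiPath E
  top_eq : left.first = right.first

/-- The top of a trek. -/
def Trek.top {V : Type*} {E : V → V → Prop} (τ : Trek E) : V := τ.left.first

/-- A trek system without sided intersection from the enumerated set
`X = {x 0, …, x (r-1)}` to `Y = {y 0, …, y (r-1)}`: the `i`-th trek has Left-endpoint `x i`
and Right-endpoint `y (perm i)`, no two Left-paths share a vertex, and no two Right-paths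
share a vertex. -/
structure TrekSystem {V : Type*} (E : V → V → Prop) (r : ℕ) (x y : Fin r → V) where
  trek : Fin r → Trek E
  perm : Equiv.Perm (Fin r)
  left_last : ∀ i, (trek i).left.last = x i
  right_last : ∀ i, (trek i).right.last = y (perm i)
  left_disj : ∀ i j, i ≠ j → ∀ v ∈ (trek i).left.verts, v ∉ (trek j).left.verts
  right_disj : ∀ i j, i ≠ j → ∀ v ∈ (trek i).right.verts, v ∉ (trek j).right.verts

/-- The list of vertices visited by a trek, with the top counted once: the vertices of the
Left path followed by the vertices of the Right path other than the top. -/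
def Trek.vertsList {V : Type*} {E : V → V → Prop} (τ : Trek E) : List V :=
  τ.left.verts ++ τ.right.verts.tail

/-- A latent-factor half-trek (for the partition of the vertices into observed set `O` and
latent set `L`): a trek that is either a directed path `v → x_1 → ⋯ → x_n → w` with all
vertices observed (the Left path is the empty path at `v = top`), or of the form
`v ← l → x_1 → ⋯ → x_n → w` with latent top `l ∈ L` and all other vertices observed. -/
def IsLFHT {V : Type*} {E : V → V → Prop} (O L : Set V) (τ : Trek E) : Prop :=
  (τ.left.verts.length = 1 ∧ ∀ u ∈ τ.right.verts, u ∈ O) ∨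
    (τ.left.verts.length = 2 ∧ τ.top ∈ L ∧ (∀ u ∈ τ.left.verts.tail, u ∈ O) ∧
      ∀ u ∈ τ.right.verts.tail, u ∈ O)

/-- The edge set `G(T)` of a trek system: the edges used by the treks of `T`. -/
def TrekSystem.edgeSet {V : Type*} {E : V → V → Prop} {r : ℕ} {x y : Fin r → V}
    (T : TrekSystem E r x y) (u w : V) : Prop :=
  ∃ i, (u, w) ∈ (T.trek i).left.edges ∨ (u, w) ∈ (T.trek i).right.edges

/-- The observed parents `pa_O(u)` of `u`: observed vertices `w` with an edge `w → u`. -/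
def paO {V : Type*} [Fintype V] [DecidableEq V] (DO : Finset (V × V)) (O : Finset V)
    (u : V) : Finset V :=
  Finset.univ.filter fun w => (w, u) ∈ DO ∧ w ∈ O

/-- The latent parents `pa_L(u)` of `u`: latent vertices `l` with an edge `l → u`. -/
def paL {V : Type*} [Fintype V] [DecidableEq V] (DO : Finset (V × V)) (L : Finset V)
    (u : V) : Finset V :=
  Finset.univ.filter fun l => (l, u) ∈ DO ∧ l ∈ L

/-- `b` is half-trek reachable from `a` avoiding `L'`: some latent-factor half-trek from
`a` to `b` passes through no element of `L'`. -/
def HtrReach {V : Type*} (E : V → V → Prop) (O L : Set V) (L' : Finset V)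
    (a b : V) : Prop :=
  ∃ τ : Trek E, IsLFHT O L τ ∧ τ.left.last = a ∧ τ.right.last = b ∧
    ∀ u ∈ τ.vertsList, u ∉ L'

/-- The subfield `K_S` of `𝕂`: the smallest subfield containing all rational functions of
`z` alone (i.e. generated by the real constants and `z`) together with all spectrum entries
`S_{o,o'}` for observed `o, o'`. -/
noncomputable def KS {V : Type*} [Fintype V] [DecidableEq V] (DO : Finset (V × V))
    (Kf : V × V → Finset ℕ) (σ : GField V ≃+* GField V) (O : Finset V) :
    Subfield (GField V) :=
  Subfield.closure (Set.range (gconst : ℝ → GField V) ∪ {gv (GVar.z : GVar V)} ∪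
    {s | ∃ o ∈ O, ∃ o' ∈ O, s = Smat DO Kf σ o o'})

section SpecSection

variable {V : Type*} {F : Type*} [Field F]

/-- Specialisation relation along a ring homomorphism. -/
def Sp (e : MvPolynomial (GVar V) ℝ →+* F) (x : GField V) (r : F) : Prop :=
  ∃ a b : MvPolynomial (GVar V) ℝ, e b ≠ 0 ∧
    x * algebraMap (MvPolynomial (GVar V) ℝ) (GField V) b =
      algebraMap (MvPolynomial (GVar V) ℝ) (GField V) a ∧ r * e b = e a

variable {e : MvPolynomial (GVar V) ℝ →+* F}

lemma Sp.of (a : MvPolynomial (GVar V) ℝ) :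
    Sp e (algebraMap (MvPolynomial (GVar V) ℝ) (GField V) a) (e a) :=
  ⟨a, 1, by simp, by simp, by simp⟩

lemma Sp.zero : Sp e 0 0 := ⟨0, 1, by simp, by simp, by simp⟩
lemma Sp.one : Sp e 1 1 := ⟨1, 1, by simp, by simp, by simp⟩

lemma Sp.add {x x' : GField V} {r r' : F} (h : Sp e x r) (h' : Sp e x' r') :
    Sp e (x + x') (r + r') := by
  obtain ⟨a, b, hb, h1, h2⟩ := h
  obtain ⟨a', b', hb', h1', h2'⟩ := h'
  refine ⟨a * b' + a' * b, b * b', by simp [hb, hb'], ?_, ?_⟩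
  · simp only [map_add, map_mul]
    linear_combination (algebraMap _ (GField V) b') * h1 + (algebraMap _ (GField V) b) * h1'
  · simp only [map_add, map_mul]
    linear_combination (e b') * h2 + (e b) * h2'

lemma Sp.mul {x x' : GField V} {r r' : F} (h : Sp e x r) (h' : Sp e x' r') :
    Sp e (x * x') (r * r') := by
  obtain ⟨a, b, hb, h1, h2⟩ := h
  obtain ⟨a', b', hb', h1', h2'⟩ := h'
  refine ⟨a * a', b * b', by simp [hb, hb'], ?_, ?_⟩
  · simp only [map_mul]
    rw [← h1, ← h1']; ring
  · simp only [map_mul]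
    rw [← h2, ← h2']; ring

lemma Sp.neg {x : GField V} {r : F} (h : Sp e x r) : Sp e (-x) (-r) := by
  obtain ⟨a, b, hb, h1, h2⟩ := h
  exact ⟨-a, b, hb, by simp [← h1], by simp [← h2]⟩

lemma Sp.sub {x x' : GField V} {r r' : F} (h : Sp e x r) (h' : Sp e x' r') :
    Sp e (x - x') (r - r') := by
  rw [sub_eq_add_neg, sub_eq_add_neg]; exact h.add h'.neg

lemma Sp.eq_zero {r : F} (h : Sp e (0 : GField V) r) : r = 0 := by
  obtain ⟨a, b, hb, h1, h2⟩ := h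
  have ha : a = 0 := by
    apply IsFractionRing.injective (MvPolynomial (GVar V) ℝ) (GField V)
    rw [← h1]; simp
  rw [ha, map_zero] at h2
  exact (mul_eq_zero.mp h2).resolve_right hb

lemma Sp.ne_zero {x : GField V} {r : F} (h : Sp e x r) (hr : r ≠ 0) : x ≠ 0 := by
  rintro rfl; exact hr h.eq_zero

lemma Sp.inv {x : GField V} {r : F} (h : Sp e x r) (hr : r ≠ 0) : Sp e x⁻¹ r⁻¹ := by
  have hx := h.ne_zero hr
  obtain ⟨a, b, hb, h1, h2⟩ := h
  refine ⟨b, a, ?_, ?_, ?_⟩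
  · rw [← h2]; exact mul_ne_zero hr hb
  · rw [← h1]; field_simp
  · rw [← h2]; field_simp

lemma Sp.div {x x' : GField V} {r r' : F} (h : Sp e x r) (h' : Sp e x' r') (hr : r' ≠ 0) :
    Sp e (x / x') (r / r') := by
  rw [div_eq_mul_inv, div_eq_mul_inv]; exact h.mul (h'.inv hr)

lemma Sp.sum {ι : Type*} (s : Finset ι) {f : ι → GField V} {g : ι → F}
    (h : ∀ i ∈ s, Sp e (f i) (g i)) : Sp e (∑ i ∈ s, f i) (∑ i ∈ s, g i) := by
  classical
  induction s using Finset.induction_on with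
  | empty => simpa using Sp.zero
  | insert a s ha ih =>
    rw [Finset.sum_insert ha, Finset.sum_insert ha]
    exact (h a (by simp)).add (ih fun i hi => h i (by simp [hi]))

lemma Sp.prod {ι : Type*} (s : Finset ι) {f : ι → GField V} {g : ι → F}
    (h : ∀ i ∈ s, Sp e (f i) (g i)) : Sp e (∏ i ∈ s, f i) (∏ i ∈ s, g i) := by
  classical
  induction s using Finset.induction_on with
  | empty => simpa using Sp.one
  | insert a s ha ih =>
    rw [Finset.prod_insert ha, Finset.prod_insert ha]
    exact (h a (by simp)).mul (ih fun i hi => h i (by simp [hi]))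

lemma Sp.pow {x : GField V} {r : F} (h : Sp e x r) (n : ℕ) : Sp e (x ^ n) (r ^ n) := by
  induction n with
  | zero => simpa using Sp.one
  | succ n ih => rw [pow_succ, pow_succ]; exact ih.mul h

lemma Sp.det {ι : Type*} [Fintype ι] [DecidableEq ι] {M : Matrix ι ι (GField V)}
    {m : Matrix ι ι F} (h : ∀ i j, Sp e (M i j) (m i j)) : Sp e M.det m.det := by
  rw [Matrix.det_apply, Matrix.det_apply]
  refine Sp.sum _ fun π _ => ?_
  have hp : Sp e (∏ i, M (π i) i) (∏ i, m (π i) i) := Sp.prod _ fun i _ => h _ _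
  rcases Int.units_eq_one_or (Equiv.Perm.sign π) with h1 | h1 <;> rw [h1]
  · simpa using hp
  · simpa using hp.neg

lemma Sp.matInv {ι : Type*} [Fintype ι] [DecidableEq ι] {M : Matrix ι ι (GField V)}
    {m : Matrix ι ι F} (h : ∀ i j, Sp e (M i j) (m i j)) (hd : m.det ≠ 0) (i j : ι) :
    Sp e (M⁻¹ i j) (m⁻¹ i j) := by
  rw [Matrix.inv_def, Matrix.inv_def, Matrix.smul_apply, Matrix.smul_apply,
    Matrix.adjugate_apply, Matrix.adjugate_apply, Ring.inverse_eq_inv', Ring.inverse_eq_inv',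
    smul_eq_mul, smul_eq_mul]
  refine ((Sp.det h).inv hd).mul (Sp.det fun a b => ?_)
  rw [Matrix.updateRow_apply, Matrix.updateRow_apply]
  split_ifs
  · rw [Pi.single_apply, Pi.single_apply]
    split_ifs
    · exact Sp.one
    · exact Sp.zero
  · exact h a b

end SpecSection

section RankSection

/-- rank function of an acyclic graph -/
lemma exists_rank_of_acyclic {V : Type*} [Fintype V] (E : V → V → Prop)
    (hacyc : ∀ v : V, ¬ Relation.TransGen E v v) :
    ∃ ρ : V → ℕ, ∀ u w, E u w → ρ u < ρ w := by
  classical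
  refine ⟨fun w => (Finset.univ.filter fun u => Relation.TransGen E u w).card, ?_⟩
  intro u w huw
  apply Finset.card_lt_card
  rw [Finset.ssubset_iff_of_subset]
  · exact ⟨u, by simpa using Relation.TransGen.single huw, by simpa using hacyc u⟩
  · intro x hx
    simp only [Finset.mem_filter, Finset.mem_univ, true_and] at hx ⊢
    exact hx.tail huw

lemma det_one_sub_of_rank {V : Type*} [Fintype V] [DecidableEq V] {F : Type*} [Field F]
    (h : Matrix V V F) (ρ : V → ℕ) (hρ : ∀ u w, h u w ≠ 0 → ρ u < ρ w) :
    (1 - h).det = 1 := by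
  have hb : (1 - h).BlockTriangular ρ := by
    intro i j hij
    have h1 : i ≠ j := by rintro rfl; exact lt_irrefl _ hij
    have h2 : h i j = 0 := by
      by_contra h3
      exact absurd (hρ i j h3) (by omega)
    simp [h1, h2]
  rw [hb.det]
  refine Finset.prod_eq_one fun a _ => ?_
  have : (1 - h).toSquareBlock ρ a = 1 := by
    ext i j
    have h2 : h i.1 j.1 = 0 := by
      by_contra h3
      have := hρ _ _ h3
      rw [i.2, j.2] at this
      exact lt_irrefl _ this
    simp [Matrix.toSquareBlock_def, h2, Matrix.one_apply, Subtype.ext_iff]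
  rw [this, Matrix.det_one]

lemma nodup_of_rank {V : Type*} {E : V → V → Prop} (ρ : V → ℕ)
    (hρ : ∀ u w, E u w → ρ u < ρ w) (p : DiPath E) : p.verts.Nodup := by
  have h1 : p.verts.IsChain (fun a b => ρ a < ρ b) := p.chain.imp (fun a b h => hρ a b h)
  have : Trans (fun a b : V => ρ a < ρ b) (fun a b : V => ρ a < ρ b)
    (fun a b : V => ρ a < ρ b) := ⟨fun h h' => lt_trans h h'⟩
  have h2 := List.isChain_iff_pairwise.mp h1
  exact h2.imp (fun h => by rintro rfl; exact lt_irrefl _ h)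

lemma zip_tail_sum {V : Type*} [Fintype V] [DecidableEq V] {F : Type*} [Field F]
    (l : List V) (hl : l.Nodup) (u : V) :
    (∑ u' : V, if (u', u) ∈ l.zip l.tail then (1 : F) else 0) =
      if u ∈ l.tail then 1 else 0 := by
  induction l with
  | nil => simp
  | cons a l ih =>
    cases l with
    | nil => simp
    | cons b l =>
      have ih := ih hl.of_cons
      simp only [List.tail_cons, List.zip_cons_cons, List.mem_cons, Prod.mk.injEq] at ih ⊢
      by_cases hub : u = b
      · subst hub
        have : ∀ u', ¬ (u', u) ∈ (u :: l).zip l := by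
          intro u' h
          have := (List.of_mem_zip h).2
          simp at hl
          tauto
        simp [this]
      · simp only [hub, and_false, false_or]
        exact ih

end RankSection
section PathSection

open Classical in
/-- indicator matrix of the edges of a path family -/
noncomputable def edgeInd {V : Type*} {E : V → V → Prop} {r : ℕ} (p : Fin r → DiPath E) :
    Matrix V V ℝ :=
  fun u w => if ∃ i, (u, w) ∈ (p i).edges then 1 else 0

lemma DiPath.edge_left_mem {V : Type*} {E : V → V → Prop} (p : DiPath E) {u w : V}
    (h : (u, w) ∈ p.edges) : u ∈ p.verts := (List.of_mem_zip h).1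

lemma DiPath.edge_right_mem {V : Type*} {E : V → V → Prop} (p : DiPath E) {u w : V}
    (h : (u, w) ∈ p.edges) : w ∈ p.verts := List.mem_of_mem_tail (List.of_mem_zip h).2

lemma zip_tail_chain {V : Type*} {E : V → V → Prop} (l : List V) (hl : l.IsChain E)
    {u w : V} (h : (u, w) ∈ l.zip l.tail) : E u w := by
  induction l with
  | nil => simp at h
  | cons a l ih =>
    cases l with
    | nil => simp at h
    | cons b l =>
      rw [List.isChain_cons_cons] at hl
      simp only [List.tail_cons, List.zip_cons_cons, List.mem_cons, Prod.mk.injEq] at h ih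
      rcases h with ⟨rfl, rfl⟩ | h
      · exact hl.1
      · exact ih hl.2 h

lemma DiPath.edge_rel {V : Type*} {E : V → V → Prop} (p : DiPath E) {u w : V}
    (h : (u, w) ∈ p.edges) : E u w := zip_tail_chain p.verts p.chain h

lemma DiPath.first_mem {V : Type*} {E : V → V → Prop} (p : DiPath E) : p.first ∈ p.verts :=
  List.head_mem _

lemma DiPath.last_mem {V : Type*} {E : V → V → Prop} (p : DiPath E) : p.last ∈ p.verts :=
  List.getLast_mem _

lemma edgeInd_rank {V : Type*} {E : V → V → Prop} {r : ℕ} (p : Fin r → DiPath E)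
    (ρ : V → ℕ) (hρ : ∀ u w, E u w → ρ u < ρ w) (u w : V) (h : edgeInd p u w ≠ 0) :
    ρ u < ρ w := by
  unfold edgeInd at h
  split_ifs at h with h1
  · obtain ⟨i, hi⟩ := h1
    exact hρ _ _ ((p i).edge_rel hi)
  · exact absurd rfl h

lemma head_tail_ind {V : Type*} [DecidableEq V] (l : List V) (hne : l ≠ []) (hnd : l.Nodup)
    (w : V) : ((if w ∈ l then 1 else 0) - (if w ∈ l.tail then 1 else 0) : ℝ) =
      if w = l.head hne then 1 else 0 := by
  cases l with
  | nil => exact absurd rfl hne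
  | cons a l =>
    simp only [List.nodup_cons] at hnd
    by_cases hwa : w = a
    · subst hwa; simp [hnd.1]
    · by_cases hwl : w ∈ l <;> simp [hwa, hwl]

open Classical in
lemma edgeInd_inv {V : Type*} [Fintype V] [DecidableEq V] {E : V → V → Prop} {r : ℕ}
    (p : Fin r → DiPath E)
    (hdisj : ∀ i j, i ≠ j → ∀ v ∈ (p i).verts, v ∉ (p j).verts)
    (ρ : V → ℕ) (hρ : ∀ u w, E u w → ρ u < ρ w) (j : Fin r) (u : V) :
    (1 - edgeInd p)⁻¹ (p j).first u = if u ∈ (p j).verts then 1 else 0 := by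
  have hdet : (1 - edgeInd p).det = 1 := det_one_sub_of_rank _ ρ (edgeInd_rank p ρ hρ)
  have hu : IsUnit (1 - edgeInd p).det := by rw [hdet]; exact isUnit_one
  set rr : V → ℝ := fun u => if u ∈ (p j).verts then 1 else 0 with hrr
  have hnd := nodup_of_rank ρ hρ (p j)
  have key : rr ᵥ* (1 - edgeInd p) = Pi.single (p j).first 1 := by
    rw [Matrix.vecMul_sub, Matrix.vecMul_one]
    ext w
    have h1 : (rr ᵥ* edgeInd p) w = if w ∈ (p j).verts.tail then 1 else 0 := by
      rw [← zip_tail_sum (p j).verts hnd w]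
      simp only [Matrix.vecMul, dotProduct]
      refine Finset.sum_congr rfl fun u' _ => ?_
      simp only [hrr, edgeInd]
      by_cases h : (u', w) ∈ (p j).edges
      · have h2 := (p j).edge_left_mem h
        have h3 : ∃ i, (u', w) ∈ (p i).edges := ⟨j, h⟩
        have h4 : (u', w) ∈ (p j).verts.zip (p j).verts.tail := h
        simp [h2, h3, h4]
      · have h4 : (u', w) ∉ (p j).verts.zip (p j).verts.tail := h
        rw [if_neg h4]
        by_cases h2 : u' ∈ (p j).verts
        · have h3 : ¬ ∃ i, (u', w) ∈ (p i).edges := by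
            rintro ⟨i, hi⟩
            by_cases hij : i = j
            · subst hij; exact h hi
            · exact hdisj i j hij u' ((p i).edge_left_mem hi) h2
          simp [h3]
        · simp [h2]
    rw [Pi.sub_apply, h1, Pi.single_apply]
    simp only [hrr, DiPath.first]
    exact head_tail_ind _ (p j).ne hnd w
  have h2 : rr = Pi.single (p j).first 1 ᵥ* (1 - edgeInd p)⁻¹ := by
    rw [← key, Matrix.vecMul_vecMul, Matrix.mul_nonsing_inv _ hu, Matrix.vecMul_one]
  have h3 := congrFun h2 u
  rw [Matrix.single_one_vecMul] at h3
  exact h3.symm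

end PathSection

section KeySection

variable {V : Type*} [Fintype V] [DecidableEq V]

/-- the total transfer matrix -/
noncomputable def Nmat (DO : Finset (V × V)) (Kf : V × V → Finset ℕ) :
    Matrix V V (GField V) := (1 - Hmat DO Kf)⁻¹

/-- the one-step latent matrix -/
noncomputable def Cmat (DO : Finset (V × V)) (Kf : V × V → Finset ℕ) (L : Finset V) :
    Matrix V V (GField V) :=
  fun s y => (if s = y then 1 else 0) + (if s ∈ L then Hmat DO Kf s y else 0)

open Classical in
/-- real specialisation associated with a path family -/
noncomputable def evR {E : V → V → Prop} {r : ℕ} (Kf : V × V → Finset ℕ)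
    (p : Fin r → DiPath E) : GVar V → ℝ
  | GVar.phi u w k => if (∃ i, (u, w) ∈ (p i).edges) ∧ (Kf (u, w)).min = k then 1 else 0
  | GVar.omega _ => 0
  | GVar.z => 1

lemma sp_gv {F : Type*} [Field F] (e : MvPolynomial (GVar V) ℝ →+* F) (i : GVar V) :
    Sp e (gv i) (e (MvPolynomial.X i)) := Sp.of _

lemma sp_lagR (DO : Finset (V × V)) (Kf : V × V → Finset ℕ)
    (hKedge : ∀ p ∈ DO, (Kf p).Nonempty) {r : ℕ}
    (p : Fin r → DiPath (fun a b => (a, b) ∈ DO)) (u w : V) :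
    Sp (MvPolynomial.eval (evR Kf p)) (lagPoly Kf u w) (edgeInd p u w) := by
  have h1 : edgeInd p u w = ∑ k ∈ Kf (u, w), evR Kf p (GVar.phi u w k) * 1 ^ k := by
    unfold edgeInd evR
    split_ifs with h
    · simp only [h, true_and, one_pow, mul_one]
      obtain ⟨i, hi⟩ := h
      have hne := hKedge _ ((p i).edge_rel hi)
      rw [Finset.sum_eq_single ((Kf (u, w)).min' hne)]
      · rw [if_pos]; exact (Finset.coe_min' hne).symm
      · intro b _ hb
        rw [if_neg]
        intro h3
        apply hb
        rw [← Finset.coe_min' hne] at h3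
        exact (WithTop.coe_injective h3).symm
      · intro h3; exact absurd (Finset.min'_mem _ hne) h3
    · simp [h]
  rw [h1]
  unfold lagPoly
  refine Sp.sum _ fun k _ => ?_
  refine Sp.mul ?_ (Sp.pow ?_ k)
  · have := sp_gv (MvPolynomial.eval (evR Kf p)) (GVar.phi u w k)
    rwa [MvPolynomial.eval_X] at this
  · have := sp_gv (MvPolynomial.eval (evR Kf p)) (GVar.z)
    rwa [MvPolynomial.eval_X] at this

lemma sp_HR (DO : Finset (V × V)) (hDO : ∀ p ∈ DO, p.1 ≠ p.2) (Kf : V × V → Finset ℕ)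
    (hKedge : ∀ p ∈ DO, (Kf p).Nonempty) {r : ℕ}
    (p : Fin r → DiPath (fun a b => (a, b) ∈ DO)) (u w : V) :
    Sp (MvPolynomial.eval (evR Kf p)) (Hmat DO Kf u w) (edgeInd p u w) := by
  unfold Hmat
  split_ifs with h
  · have h1 := sp_lagR DO Kf hKedge p w w
    have h2 : edgeInd p w w = 0 := by
      unfold edgeInd
      rw [if_neg]
      rintro ⟨i, hi⟩
      exact hDO _ ((p i).edge_rel hi) rfl
    rw [h2] at h1
    have h3 := (sp_lagR DO Kf hKedge p u w).div (Sp.one.sub h1) (by simp)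
    simpa using h3
  · have h2 : edgeInd p u w = 0 := by
      unfold edgeInd
      rw [if_neg]
      rintro ⟨i, hi⟩
      exact h ((p i).edge_rel hi)
    rw [h2]
    exact Sp.zero

open Classical in
lemma key_det (DO : Finset (V × V)) (hDO : ∀ p ∈ DO, p.1 ≠ p.2)
    (ρ : V → ℕ) (hρ : ∀ u w, (u, w) ∈ DO → ρ u < ρ w)
    (Kf : V × V → Finset ℕ)
    (hKedge : ∀ p ∈ DO, (Kf p).Nonempty) (O L : Finset V) (hOL : Disjoint O L) {r : ℕ}
    (p : Fin r → DiPath (fun a b => (a, b) ∈ DO))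
    (hdisj : ∀ i j, i ≠ j → ∀ v ∈ (p i).verts, v ∉ (p j).verts)
    (q : Fin r → Prop)
    (hq : ∀ i, ¬ q i → (p i).last ∈ O ∧
      ((p i).verts.length = 1 ∨ ((p i).verts.length = 2 ∧ (p i).first ∈ L))) :
    (Matrix.of fun j i : Fin r => if q i then Nmat DO Kf (p j).first (p i).last
      else Cmat DO Kf L (p j).first (p i).last).det ≠ 0 := by
  have hH := sp_HR DO hDO Kf hKedge p
  have hone : ∀ a b, Sp (MvPolynomial.eval (evR Kf p)) ((1 : Matrix V V (GField V)) a b)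
      ((1 : Matrix V V ℝ) a b) := by
    intro a b
    rw [Matrix.one_apply, Matrix.one_apply]
    split_ifs
    · exact Sp.one
    · exact Sp.zero
  have hN : ∀ a b, Sp (MvPolynomial.eval (evR Kf p)) (Nmat DO Kf a b)
      ((1 - edgeInd p)⁻¹ a b) := by
    apply Sp.matInv
    · intro a b; exact (hone a b).sub (hH a b)
    · rw [det_one_sub_of_rank _ ρ (edgeInd_rank p ρ hρ)]; exact one_ne_zero
  have hlast : ∀ i j, (p i).last ∈ (p j).verts → i = j := by
    intro i j h
    by_contra hij
    exact hdisj i j hij _ (p i).last_mem h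
  have hfirst : ∀ i j, (p i).first ∈ (p j).verts → i = j := by
    intro i j h
    by_contra hij
    exact hdisj i j hij _ (p i).first_mem h
  have hspec : Sp (MvPolynomial.eval (evR Kf p)) (Matrix.of fun j i : Fin r =>
      if q i then Nmat DO Kf (p j).first (p i).last
      else Cmat DO Kf L (p j).first (p i).last).det (1 : Matrix (Fin r) (Fin r) ℝ).det := by
    apply Sp.det
    intro j i
    rw [Matrix.of_apply]
    split_ifs with hqi
    · have h1 := hN (p j).first (p i).last
      rw [edgeInd_inv p hdisj ρ hρ] at h1
      convert h1 using 1
      rw [Matrix.one_apply]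
      by_cases hij : j = i
      · subst hij; simp [(p j).last_mem]
      · rw [if_neg hij, if_neg]
        intro h; exact hij (hlast _ _ h).symm
    · obtain ⟨hO, hlen⟩ := hq i hqi
      have hC : Sp (MvPolynomial.eval (evR Kf p)) (Cmat DO Kf L (p j).first (p i).last)
          ((if (p j).first = (p i).last then 1 else 0) +
            (if (p j).first ∈ L then edgeInd p (p j).first (p i).last else 0)) := by
        unfold Cmat
        apply Sp.add
        · split_ifs
          · exact Sp.one
          · exact Sp.zero
        · split_ifs
          · exact hH _ _
          · exact Sp.zero
      convert hC using 1
      rw [Matrix.one_apply]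
      by_cases hij : j = i
      · subst hij
        rw [if_pos rfl]
        rcases hlen with hlen | ⟨hlen, hfL⟩
        · have h1 : (p j).first = (p j).last := by
            obtain ⟨a, ha⟩ := List.length_eq_one_iff.mp hlen
            simp [DiPath.first, DiPath.last, ha]
          have h2 : (p j).first ∉ L := by
            rw [h1]; exact Finset.disjoint_left.mp hOL hO
          rw [if_pos h1, if_neg h2, add_zero]
        · have h1 : (p j).first ≠ (p j).last := by
            intro h; rw [h] at hfL; exact Finset.disjoint_left.mp hOL hO hfL
          rw [if_neg h1, if_pos hfL, edgeInd, if_pos, zero_add]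
          refine ⟨j, ?_⟩
          obtain ⟨a, b, ha⟩ := List.length_eq_two.mp hlen
          simp [DiPath.first, DiPath.last, DiPath.edges, ha]
      · have h1 : (p j).first ≠ (p i).last := by
          intro h
          exact hij (hfirst j i (h ▸ (p i).last_mem))
        have h2 : edgeInd p (p j).first (p i).last = 0 := by
          rw [edgeInd, if_neg]
          rintro ⟨k, hk⟩
          have h3 := hfirst _ _ ((p k).edge_left_mem hk)
          have h4 := hlast _ _ ((p k).edge_right_mem hk)
          exact hij (h3.trans h4.symm)
        rw [if_neg hij, if_neg h1, h2]
        simp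
  exact hspec.ne_zero (by simp)

end KeySection
section OmegaSection

variable {V : Type*} [Fintype V] [DecidableEq V]

/-- the diagonal entries of the internal spectrum -/
noncomputable def dS (Kf : V × V → Finset ℕ) (σ : GField V ≃+* GField V) (v : V) : GField V :=
  gv (GVar.omega v) / ((1 - lagPoly Kf v v) * σ (1 - lagPoly Kf v v))

open Classical in
/-- specialisation of the omegas -/
noncomputable def omF {r : ℕ} (s : Fin r → V) : GVar V → GField V
  | GVar.phi u w k => gv (GVar.phi u w k)
  | GVar.omega u => if u ∈ Set.range s then 1 else 0
  | GVar.z => gv GVar.z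

/-- specialisation homomorphism of the omegas -/
noncomputable def evO {r : ℕ} (s : Fin r → V) : MvPolynomial (GVar V) ℝ →+* GField V :=
  MvPolynomial.eval₂Hom ((algebraMap (MvPolynomial (GVar V) ℝ) (GField V)).comp
    MvPolynomial.C) (omF s)

lemma gz_ne : (gv (GVar.z : GVar V)) ≠ 0 := by
  unfold gv
  intro h
  rw [← map_zero (algebraMap (MvPolynomial (GVar V) ℝ) (GField V))] at h
  exact MvPolynomial.X_ne_zero _ (IsFractionRing.injective (MvPolynomial (GVar V) ℝ)
    (GField V) h)

lemma one_sub_lag_ne (Kf : V × V → Finset ℕ) (w : V) : 1 - lagPoly Kf w w ≠ 0 := by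
  have h := sp_lagR ∅ Kf (by simp) (r := 0) (fun i => i.elim0) w w
  have h2 := Sp.one.sub h
  refine h2.ne_zero ?_
  simp [edgeInd]

lemma spO_z {r : ℕ} (s : Fin r → V) : Sp (evO s) (gv (GVar.z : GVar V)) (gv GVar.z) := by
  have := sp_gv (evO s) (GVar.z)
  simpa [evO, omF] using this

lemma spO_lag {r : ℕ} (s : Fin r → V) (Kf : V × V → Finset ℕ) (u w : V) :
    Sp (evO s) (lagPoly Kf u w) (lagPoly Kf u w) := by
  unfold lagPoly
  refine Sp.sum _ fun k _ => Sp.mul ?_ ((spO_z s).pow k)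
  have := sp_gv (evO s) (GVar.phi u w k)
  simpa [evO, omF] using this

lemma sig_lag (σ : GField V ≃+* GField V)
    (hσz : σ (gv (GVar.z : GVar V)) = (gv (GVar.z : GVar V))⁻¹)
    (hσφ : ∀ (v w : V) (k : ℕ), σ (gv (GVar.phi v w k)) = gv (GVar.phi v w k))
    (Kf : V × V → Finset ℕ) (u w : V) :
    σ (lagPoly Kf u w) = ∑ k ∈ Kf (u, w), gv (GVar.phi u w k) * (gv GVar.z)⁻¹ ^ k := by
  simp [lagPoly, map_sum, hσφ, hσz]

lemma sig_sig_lag (σ : GField V ≃+* GField V)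
    (hσz : σ (gv (GVar.z : GVar V)) = (gv (GVar.z : GVar V))⁻¹)
    (hσφ : ∀ (v w : V) (k : ℕ), σ (gv (GVar.phi v w k)) = gv (GVar.phi v w k))
    (Kf : V × V → Finset ℕ) (u w : V) : σ (σ (lagPoly Kf u w)) = lagPoly Kf u w := by
  simp [lagPoly, map_sum, hσφ, hσz]

lemma sig_sig_H (σ : GField V ≃+* GField V)
    (hσz : σ (gv (GVar.z : GVar V)) = (gv (GVar.z : GVar V))⁻¹)
    (hσφ : ∀ (v w : V) (k : ℕ), σ (gv (GVar.phi v w k)) = gv (GVar.phi v w k))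
    (DO : Finset (V × V)) (Kf : V × V → Finset ℕ) (u w : V) :
    σ (σ (Hmat DO Kf u w)) = Hmat DO Kf u w := by
  unfold Hmat
  split_ifs
  · simp [sig_sig_lag σ hσz hσφ]
  · simp

lemma sig_dS (σ : GField V ≃+* GField V)
    (hσz : σ (gv (GVar.z : GVar V)) = (gv (GVar.z : GVar V))⁻¹)
    (hσφ : ∀ (v w : V) (k : ℕ), σ (gv (GVar.phi v w k)) = gv (GVar.phi v w k))
    (hσω : ∀ v : V, σ (gv (GVar.omega v)) = gv (GVar.omega v))
    (Kf : V × V → Finset ℕ) (u : V) :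
    σ (dS Kf σ u) = dS Kf σ u := by
  unfold dS
  simp only [map_div₀, map_mul, map_sub, map_one, sig_sig_lag σ hσz hσφ, hσω]
  rw [mul_comm]

lemma spO_siglag (σ : GField V ≃+* GField V)
    (hσz : σ (gv (GVar.z : GVar V)) = (gv (GVar.z : GVar V))⁻¹)
    (hσφ : ∀ (v w : V) (k : ℕ), σ (gv (GVar.phi v w k)) = gv (GVar.phi v w k))
    {r : ℕ} (s : Fin r → V) (Kf : V × V → Finset ℕ) (u w : V) :
    Sp (evO s) (σ (lagPoly Kf u w)) (σ (lagPoly Kf u w)) := by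
  rw [sig_lag σ hσz hσφ]
  refine Sp.sum _ fun k _ => Sp.mul ?_ (((spO_z s).inv gz_ne).pow k)
  have := sp_gv (evO s) (GVar.phi u w k)
  simpa [evO, omF] using this

lemma spO_H {r : ℕ} (s : Fin r → V) (DO : Finset (V × V)) (Kf : V × V → Finset ℕ) (u w : V) :
    Sp (evO s) (Hmat DO Kf u w) (Hmat DO Kf u w) := by
  unfold Hmat
  split_ifs
  · exact (spO_lag s Kf u w).div (Sp.one.sub (spO_lag s Kf w w)) (one_sub_lag_ne Kf w)
  · exact Sp.zero

lemma spO_sigH (σ : GField V ≃+* GField V)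
    (hσz : σ (gv (GVar.z : GVar V)) = (gv (GVar.z : GVar V))⁻¹)
    (hσφ : ∀ (v w : V) (k : ℕ), σ (gv (GVar.phi v w k)) = gv (GVar.phi v w k))
    {r : ℕ} (s : Fin r → V) (DO : Finset (V × V)) (Kf : V × V → Finset ℕ) (u w : V) :
    Sp (evO s) (σ (Hmat DO Kf u w)) (σ (Hmat DO Kf u w)) := by
  unfold Hmat
  split_ifs
  · rw [map_div₀, map_sub, map_one]
    refine (spO_siglag σ hσz hσφ s Kf u w).div
      (Sp.one.sub (spO_siglag σ hσz hσφ s Kf w w)) ?_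
    have := (map_ne_zero σ).mpr (one_sub_lag_ne Kf w)
    rwa [map_sub, map_one] at this
  · rw [map_zero]; exact Sp.zero

lemma H_rank (DO : Finset (V × V)) (Kf : V × V → Finset ℕ)
    (ρ : V → ℕ) (hρ : ∀ u w, (u, w) ∈ DO → ρ u < ρ w) (u w : V) (h : Hmat DO Kf u w ≠ 0) :
    ρ u < ρ w := by
  unfold Hmat at h
  split_ifs at h with h1
  · exact hρ _ _ h1
  · exact absurd rfl h

lemma det_H (DO : Finset (V × V)) (Kf : V × V → Finset ℕ)
    (ρ : V → ℕ) (hρ : ∀ u w, (u, w) ∈ DO → ρ u < ρ w) : (1 - Hmat DO Kf).det = 1 :=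
  det_one_sub_of_rank _ ρ (H_rank DO Kf ρ hρ)

lemma N_map (σ : GField V ≃+* GField V) (DO : Finset (V × V)) (Kf : V × V → Finset ℕ)
    (ρ : V → ℕ) (hρ : ∀ u w, (u, w) ∈ DO → ρ u < ρ w) :
    (1 - (Hmat DO Kf).map σ)⁻¹ = (Nmat DO Kf).map σ := by
  apply Matrix.inv_eq_left_inv
  have h1 : (1 - (Hmat DO Kf).map σ) = (1 - Hmat DO Kf).map σ := by
    ext i j
    simp [Matrix.one_apply, apply_ite σ]
  have hu : IsUnit (1 - Hmat DO Kf).det := by rw [det_H DO Kf ρ hρ]; exact isUnit_one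
  rw [h1, ← Matrix.map_mul, Nmat, Matrix.nonsing_inv_mul _ hu]
  ext i j
  simp [Matrix.one_apply, apply_ite σ]

lemma spO_N {r : ℕ} (s : Fin r → V) (DO : Finset (V × V)) (Kf : V × V → Finset ℕ)
    (ρ : V → ℕ) (hρ : ∀ u w, (u, w) ∈ DO → ρ u < ρ w) (u w : V) :
    Sp (evO s) (Nmat DO Kf u w) (Nmat DO Kf u w) := by
  apply Sp.matInv
  · intro a b
    rw [Matrix.sub_apply, Matrix.one_apply]
    refine Sp.sub ?_ (spO_H s DO Kf a b)
    split_ifs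
    · exact Sp.one
    · exact Sp.zero
  · rw [det_H DO Kf ρ hρ]; exact one_ne_zero

lemma spO_sigN (σ : GField V ≃+* GField V)
    (hσz : σ (gv (GVar.z : GVar V)) = (gv (GVar.z : GVar V))⁻¹)
    (hσφ : ∀ (v w : V) (k : ℕ), σ (gv (GVar.phi v w k)) = gv (GVar.phi v w k))
    {r : ℕ} (s : Fin r → V) (DO : Finset (V × V)) (Kf : V × V → Finset ℕ)
    (ρ : V → ℕ) (hρ : ∀ u w, (u, w) ∈ DO → ρ u < ρ w) (u w : V) :
    Sp (evO s) (σ (Nmat DO Kf u w)) (σ (Nmat DO Kf u w)) := by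
  have h : σ (Nmat DO Kf u w) = (1 - (Hmat DO Kf).map σ)⁻¹ u w := by
    rw [N_map σ DO Kf ρ hρ]; rfl
  rw [h]
  apply Sp.matInv
  · intro a b
    rw [Matrix.sub_apply, Matrix.one_apply]
    refine Sp.sub ?_ (spO_sigH σ hσz hσφ s DO Kf a b)
    split_ifs
    · exact Sp.one
    · exact Sp.zero
  · rw [det_one_sub_of_rank _ ρ]
    · exact one_ne_zero
    · intro a b hab
      apply H_rank DO Kf ρ hρ
      intro h0
      apply hab
      simp [h0]

lemma spO_C {r : ℕ} (s : Fin r → V) (DO : Finset (V × V)) (Kf : V × V → Finset ℕ)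
    (L : Finset V) (u w : V) :
    Sp (evO s) (Cmat DO Kf L u w) (Cmat DO Kf L u w) := by
  unfold Cmat
  apply Sp.add
  · split_ifs
    · exact Sp.one
    · exact Sp.zero
  · split_ifs
    · exact spO_H s DO Kf u w
    · exact Sp.zero

lemma spO_sigC (σ : GField V ≃+* GField V)
    (hσz : σ (gv (GVar.z : GVar V)) = (gv (GVar.z : GVar V))⁻¹)
    (hσφ : ∀ (v w : V) (k : ℕ), σ (gv (GVar.phi v w k)) = gv (GVar.phi v w k))
    {r : ℕ} (s : Fin r → V) (DO : Finset (V × V)) (Kf : V × V → Finset ℕ)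
    (L : Finset V) (u w : V) :
    Sp (evO s) (σ (Cmat DO Kf L u w)) (σ (Cmat DO Kf L u w)) := by
  unfold Cmat
  rw [map_add, apply_ite σ, apply_ite σ, map_one, map_zero]
  apply Sp.add
  · split_ifs
    · exact Sp.one
    · exact Sp.zero
  · split_ifs
    · exact spO_sigH σ hσz hσφ s DO Kf u w
    · exact Sp.zero

lemma M_det_ne (σ : GField V ≃+* GField V)
    (hσz : σ (gv (GVar.z : GVar V)) = (gv (GVar.z : GVar V))⁻¹)
    (hσφ : ∀ (v w : V) (k : ℕ), σ (gv (GVar.phi v w k)) = gv (GVar.phi v w k))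
    (Kf : V × V → Finset ℕ)
    {r : ℕ} (s : Fin r → V) (hs : Function.Injective s)
    (A B : V → Fin r → GField V)
    (hA : ∀ u i, Sp (evO s) (A u i) (A u i))
    (hB : ∀ u i, Sp (evO s) (σ (B u i)) (σ (B u i)))
    (hdA : (Matrix.of fun j i => A (s j) i).det ≠ 0)
    (hdB : (Matrix.of fun j i => B (s j) i).det ≠ 0) :
    (Matrix.of fun i k => ∑ u, A u i * dS Kf σ u * σ (B u k)).det ≠ 0 := by
  classical
  set dd : V → GField V := fun u => 1 / ((1 - lagPoly Kf u u) * σ (1 - lagPoly Kf u u))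
  have hne : ∀ u, (1 - lagPoly Kf u u) * σ (1 - lagPoly Kf u u) ≠ 0 := fun u =>
    mul_ne_zero (one_sub_lag_ne Kf u) ((map_ne_zero σ).mpr (one_sub_lag_ne Kf u))
  have hd : ∀ u, Sp (evO s) (dS Kf σ u) ((if u ∈ Set.range s then 1 else 0) /
      ((1 - lagPoly Kf u u) * σ (1 - lagPoly Kf u u))) := by
    intro u
    refine Sp.div ?_ (Sp.mul ?_ ?_) (hne u)
    · have := sp_gv (evO s) (GVar.omega u)
      simpa only [evO, omF, MvPolynomial.coe_eval₂Hom, MvPolynomial.eval₂_X] using this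
    · exact Sp.one.sub (spO_lag s Kf u u)
    · rw [map_sub, map_one]; exact Sp.one.sub (spO_siglag σ hσz hσφ s Kf u u)
  have hS := Sp.det (e := evO s) (M := Matrix.of fun i k => ∑ u, A u i * dS Kf σ u * σ (B u k))
    (m := Matrix.of fun i k => ∑ u, A u i * ((if u ∈ Set.range s then 1 else 0) /
      ((1 - lagPoly Kf u u) * σ (1 - lagPoly Kf u u))) * σ (B u k))
    (fun i k => Sp.sum _ fun u _ => ((hA u i).mul (hd u)).mul (hB u k))
  refine hS.ne_zero ?_
  have hfac : (Matrix.of fun i k => ∑ u, A u i * ((if u ∈ Set.range s then 1 else 0) /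
      ((1 - lagPoly Kf u u) * σ (1 - lagPoly Kf u u))) * σ (B u k)) =
      (Matrix.of fun j i => A (s j) i)ᵀ * Matrix.diagonal (fun j => dd (s j)) *
        (Matrix.of fun j i => B (s j) i).map σ := by
    ext i k
    rw [Matrix.mul_apply]
    simp only [Matrix.mul_diagonal, Matrix.of_apply, Matrix.transpose_apply, Matrix.map_apply]
    rw [← Finset.sum_image (f := fun u => A u i * dd u * σ (B u k)) (g := s)
      (fun a _ b _ h => hs h)]
    symm
    apply Finset.sum_subset_zero_on_sdiff (Finset.subset_univ _)
    · intro u hu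
      have : u ∉ Set.range s := by
        rintro ⟨j, rfl⟩
        simp at hu
      simp [this]
    · intro u hu
      have : u ∈ Set.range s := by
        simp at hu
        exact hu
      simp only [this, if_true, dd]
  rw [hfac, Matrix.det_mul, Matrix.det_mul, Matrix.det_transpose, Matrix.det_diagonal]
  refine mul_ne_zero (mul_ne_zero hdA ?_) ?_
  · exact Finset.prod_ne_zero_iff.mpr fun j _ => one_div_ne_zero (hne _)
  · have := σ.toRingHom.map_det (Matrix.of fun j i => B (s j) i)
    have h2 : ((Matrix.of fun j i => B (s j) i).map σ).det =
      σ (Matrix.of fun j i => B (s j) i).det := this.symm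
    rw [h2]
    exact (map_ne_zero σ).mpr hdB

end OmegaSection
section LinSection

lemma solve_mem {F : Type*} [Field F] (K : Subfield F) {r : ℕ} (M : Matrix (Fin r) (Fin r) F)
    (c X : Fin r → F) (hM : ∀ i j, M i j ∈ K) (hc : ∀ i, c i ∈ K) (hd : M.det ≠ 0)
    (hX : M *ᵥ X = c) (k : Fin r) : X k ∈ K := by
  set M0 : Matrix (Fin r) (Fin r) K := fun i j => ⟨M i j, hM i j⟩ with hM0
  set c0 : Fin r → K := fun i => ⟨c i, hc i⟩ with hc0
  have hmap : M0.map K.subtype = M := by ext i j; rfl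
  have hd0 : M0.det ≠ 0 := by
    intro h
    apply hd
    rw [← hmap]
    have := K.subtype.map_det M0
    rw [RingHom.mapMatrix_apply] at this
    rw [← this, h, map_zero]
  have hu : IsUnit M0.det := isUnit_iff_ne_zero.mpr hd0
  have h1 : M0 *ᵥ (M0⁻¹ *ᵥ c0) = c0 := by
    rw [Matrix.mulVec_mulVec, Matrix.mul_nonsing_inv _ hu, Matrix.one_mulVec]
  have h2 : M *ᵥ (fun i => ((M0⁻¹ *ᵥ c0) i : F)) = c := by
    ext i
    have := congrArg (K.subtype) (congrFun h1 i)
    simpa [Matrix.mulVec, dotProduct, hM0, hc0] using this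
  have h3 : Function.Injective M.mulVec :=
    Matrix.mulVec_injective_iff_isUnit.mpr
      ((Matrix.isUnit_iff_isUnit_det _).mpr (isUnit_iff_ne_zero.mpr hd))
  have h4 : X = fun i => ((M0⁻¹ *ᵥ c0) i : F) := h3 (hX.trans h2.symm)
  rw [h4]
  exact ((M0⁻¹ *ᵥ c0) k).2

variable {V : Type*} [Fintype V] [DecidableEq V]

lemma N_eq (DO : Finset (V × V)) (Kf : V × V → Finset ℕ)
    (ρ : V → ℕ) (hρ : ∀ u w, (u, w) ∈ DO → ρ u < ρ w) (s y : V) :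
    Nmat DO Kf s y = (if s = y then 1 else 0) + ∑ u, Nmat DO Kf s u * Hmat DO Kf u y := by
  have hu : IsUnit (1 - Hmat DO Kf).det := by rw [det_H DO Kf ρ hρ]; exact isUnit_one
  have h := Matrix.nonsing_inv_mul _ hu
  rw [Matrix.mul_sub, Matrix.mul_one] at h
  have h2 := congrFun (congrFun h s) y
  rw [Matrix.sub_apply, Matrix.mul_apply, Matrix.one_apply] at h2
  rw [← h2]
  simp [Nmat]

lemma N_latent (DO : Finset (V × V)) (Kf : V × V → Finset ℕ)
    (ρ : V → ℕ) (hρ : ∀ u w, (u, w) ∈ DO → ρ u < ρ w) (L : Finset V)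
    (hlat : ∀ l ∈ L, ∀ u : V, (u, l) ∉ DO) (s y : V) (hy : y ∈ L) :
    Nmat DO Kf s y = if s = y then 1 else 0 := by
  rw [N_eq DO Kf ρ hρ, Finset.sum_eq_zero, add_zero]
  intro u _
  simp [Hmat, hlat y hy u]

lemma C_eq (DO : Finset (V × V)) (Kf : V × V → Finset ℕ)
    (ρ : V → ℕ) (hρ : ∀ u w, (u, w) ∈ DO → ρ u < ρ w) (O L : Finset V)
    (hOL : Disjoint O L) (hcover : O ∪ L = Finset.univ)
    (hlat : ∀ l ∈ L, ∀ u : V, (u, l) ∉ DO) (s y : V) :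
    Cmat DO Kf L s y = Nmat DO Kf s y - ∑ u ∈ O, Nmat DO Kf s u * Hmat DO Kf u y := by
  have h1 : ∑ u ∈ L, Nmat DO Kf s u * Hmat DO Kf u y = if s ∈ L then Hmat DO Kf s y else 0 := by
    rw [Finset.sum_congr rfl (g := fun u => if s = u then Hmat DO Kf u y else 0)]
    · rw [Finset.sum_ite_eq]
    · intro u hu
      rw [N_latent DO Kf ρ hρ L hlat s u hu]
      simp
  rw [N_eq DO Kf ρ hρ s y, ← hcover, Finset.sum_union hOL, h1, Cmat]
  ring

lemma N_reach (DO : Finset (V × V)) (Kf : V × V → Finset ℕ)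
    (ρ : V → ℕ) (hρ : ∀ u w, (u, w) ∈ DO → ρ u < ρ w) (s : V) :
    ∀ (n : ℕ) (y : V), ρ y < n → Nmat DO Kf s y ≠ 0 →
      Relation.ReflTransGen (fun a b => (a, b) ∈ DO) s y := by
  intro n
  induction n with
  | zero => intro y h; omega
  | succ n ih =>
    intro y hy hN
    by_cases hsy : s = y
    · subst hsy; exact Relation.ReflTransGen.refl
    · rw [N_eq DO Kf ρ hρ, if_neg hsy, zero_add] at hN
      obtain ⟨u, _, hu⟩ := Finset.exists_ne_zero_of_sum_ne_zero hN
      have h1 := left_ne_zero_of_mul hu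
      have h2 := right_ne_zero_of_mul hu
      have h3 : (u, y) ∈ DO := by
        by_contra h3
        exact h2 (by simp [Hmat, h3])
      exact (ih u (by have := hρ _ _ h3; omega) h1).tail h3

lemma chain_incoming {E : V → V → Prop} (l : List V) :
    ∀ s, (s :: l).IsChain E → ∀ u ∈ l, ∃ u', E u' u := by
  induction l with
  | nil => intro s _ u hu; simp at hu
  | cons a l ih =>
    intro s hc u hu
    rw [List.isChain_cons_cons] at hc
    rcases List.mem_cons.mp hu with rfl | hu
    · exact ⟨s, hc.1⟩
    · exact ih a hc.2 u hu

lemma exists_path {E : V → V → Prop} {s y : V} (h : Relation.ReflTransGen E s y) :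
    ∃ (l : List V) (p : DiPath E), p.verts = s :: l ∧ p.first = s ∧ p.last = y ∧
      ∀ u ∈ l, ∃ u', E u' u := by
  obtain ⟨l, hl, hlast⟩ := List.exists_isChain_cons_of_relationReflTransGen h
  exact ⟨l, ⟨s :: l, by simp, hl⟩, rfl, rfl, hlast, chain_incoming l s hl⟩

/-- vanishing of contributions outside `L'` -/
lemma vanish (DO : Finset (V × V)) (Kf : V × V → Finset ℕ)
    (ρ : V → ℕ) (hρ : ∀ u w, (u, w) ∈ DO → ρ u < ρ w) (O L : Finset V)
    (hOL : Disjoint O L) (hcover : O ∪ L = Finset.univ)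
    (hlat : ∀ l ∈ L, ∀ u : V, (u, l) ∉ DO) (L' : Finset V) (hL' : L' ⊆ L)
    (y w s : V) (hyO : y ∈ O) (hwO : w ∈ O) (hs : s ∉ L')
    (hnr : ¬ HtrReach (fun a b => (a, b) ∈ DO) (↑O) (↑L) L' w y)
    (hC : Cmat DO Kf L s w ≠ 0) : Nmat DO Kf s y = 0 := by
  by_contra hN
  have hinO : ∀ u, (∃ u', (u', u) ∈ DO) → u ∈ O := by
    rintro u ⟨u', hu'⟩
    have : u ∈ O ∪ L := by rw [hcover]; simp
    rcases Finset.mem_union.mp this with h | h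
    · exact h
    · exact absurd hu' (hlat u h u')
  have hO' : ∀ u ∈ O, u ∉ L' := fun u hu h => Finset.disjoint_left.mp hOL hu (hL' h)
  have hreach := N_reach DO Kf ρ hρ s _ y (Nat.lt_succ_self _) hN
  obtain ⟨l, p, hp, hpf, hpl, hin⟩ := exists_path hreach
  by_cases hsw : s = w
  · subst hsw
    apply hnr
    refine ⟨⟨⟨[s], by simp, List.isChain_singleton _⟩, p, hpf.symm⟩, ?_, rfl, hpl, ?_⟩
    · left
      refine ⟨rfl, ?_⟩
      intro u hu
      simp only [hp, List.mem_cons] at hu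
      rcases hu with rfl | hu
      · exact hwO
      · exact hinO u (hin u hu)
    · intro u hu
      simp only [Trek.vertsList, hp, List.tail_cons, List.cons_append, List.nil_append,
        List.mem_cons] at hu
      rcases hu with rfl | hu
      · exact hs
      · exact hO' u (hinO u (hin u hu))
  · rw [Cmat, if_neg hsw, zero_add] at hC
    have hsL : s ∈ L := by by_contra h; exact hC (if_neg h)
    rw [if_pos hsL] at hC
    have hE : (s, w) ∈ DO := by by_contra h; exact hC (by simp [Hmat, h])
    apply hnr
    refine ⟨⟨⟨[s, w], by simp, List.isChain_pair.mpr hE⟩, p, hpf.symm⟩, ?_, rfl, hpl, ?_⟩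
    · right
      refine ⟨rfl, hsL, ?_, ?_⟩
      · intro u hu
        simp only [List.tail_cons, List.mem_singleton] at hu
        subst hu; exact hwO
      · intro u hu
        simp only [hp, List.tail_cons] at hu
        exact hinO u (hin u hu)
    · intro u hu
      simp only [Trek.vertsList, hp, List.tail_cons, List.cons_append, List.nil_append,
        List.mem_cons] at hu
      rcases hu with rfl | rfl | hu
      · exact hs
      · exact hO' _ hwO
      · exact hO' u (hinO u (hin u hu))

lemma S_eq (DO : Finset (V × V)) (Kf : V × V → Finset ℕ) (σ : GField V ≃+* GField V)
    (ρ : V → ℕ) (hρ : ∀ u w, (u, w) ∈ DO → ρ u < ρ w) (a b : V) :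
    Smat DO Kf σ a b = ∑ s, Nmat DO Kf s a * dS Kf σ s * σ (Nmat DO Kf s b) := by
  rw [Smat, N_map σ DO Kf ρ hρ, ← Matrix.transpose_nonsing_inv, SImat, Matrix.mul_apply]
  refine Finset.sum_congr rfl fun s _ => ?_
  rw [Matrix.mul_diagonal, Matrix.transpose_apply, Matrix.map_apply]
  rfl

lemma sig_sig_N (σ : GField V ≃+* GField V)
    (hσz : σ (gv (GVar.z : GVar V)) = (gv (GVar.z : GVar V))⁻¹)
    (hσφ : ∀ (v w : V) (k : ℕ), σ (gv (GVar.phi v w k)) = gv (GVar.phi v w k))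
    (DO : Finset (V × V)) (Kf : V × V → Finset ℕ)
    (ρ : V → ℕ) (hρ : ∀ u w, (u, w) ∈ DO → ρ u < ρ w) (u w : V) :
    σ (σ (Nmat DO Kf u w)) = Nmat DO Kf u w := by
  have hu : IsUnit (1 - Hmat DO Kf).det := by rw [det_H DO Kf ρ hρ]; exact isUnit_one
  have h1 : ((Nmat DO Kf).map (σ.trans σ)) = Nmat DO Kf := by
    symm
    rw [← N_map (σ.trans σ) DO Kf ρ hρ, Nmat]
    congr 2
    ext a b
    exact (sig_sig_H σ hσz hσφ DO Kf a b).symm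
  exact congrFun (congrFun h1 u) w

lemma sig_KS (σ : GField V ≃+* GField V)
    (hσz : σ (gv (GVar.z : GVar V)) = (gv (GVar.z : GVar V))⁻¹)
    (hσφ : ∀ (v w : V) (k : ℕ), σ (gv (GVar.phi v w k)) = gv (GVar.phi v w k))
    (hσω : ∀ v : V, σ (gv (GVar.omega v)) = gv (GVar.omega v))
    (hσR : ∀ a : ℝ, σ (gconst a) = (gconst a : GField V))
    (DO : Finset (V × V)) (Kf : V × V → Finset ℕ)
    (ρ : V → ℕ) (hρ : ∀ u w, (u, w) ∈ DO → ρ u < ρ w) (O : Finset V)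
    (x : GField V) (hx : x ∈ KS DO Kf σ O) : σ x ∈ KS DO Kf σ O := by
  have h : KS DO Kf σ O ≤ (KS DO Kf σ O).comap σ.toRingHom := by
    conv_lhs => rw [KS]
    rw [Subfield.closure_le]
    rintro t ((⟨a, rfl⟩ | ht) | ⟨o, ho, o', ho', rfl⟩)
    · change σ (gconst a) ∈ KS DO Kf σ O
      rw [hσR]
      exact Subfield.subset_closure (Or.inl (Or.inl ⟨a, rfl⟩))
    · rw [Set.mem_singleton_iff] at ht
      subst ht
      change σ (gv GVar.z) ∈ KS DO Kf σ O
      rw [hσz]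
      exact inv_mem (Subfield.subset_closure (Or.inl (Or.inr rfl)))
    · change σ (Smat DO Kf σ o o') ∈ KS DO Kf σ O
      have : σ (Smat DO Kf σ o o') = Smat DO Kf σ o' o := by
        rw [S_eq DO Kf σ ρ hρ, S_eq DO Kf σ ρ hρ, map_sum]
        refine Finset.sum_congr rfl fun s _ => ?_
        rw [map_mul, map_mul, sig_sig_N σ hσz hσφ DO Kf ρ hρ, sig_dS σ hσz hσφ hσω]
        ring
      rw [this]
      exact Subfield.subset_closure (Or.inr ⟨o', ho', o, ho, rfl⟩)
  exact h hx

end LinSection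
/-- spectral latent-factor half-trek criterion. In the generic
frequency-domain parameterisation of an acyclic process graph with exogenous latent
structure `V = O ⊔ L`, suppose `(Y, W, L')` satisfies the LF-HTC with respect to `v ∈ O`.
If all link functions `H_{u,y}` of edges `u → y` into vertices
`y ∈ W ∪ (Y ∩ htr_{L'}(W ∪ {v}))` lie in the subfield `K_S` generated by `ℝ(z)` and the
observed spectrum entries, then all link functions `H_{x,v}` with `x ∈ pa_O(v)` lie in
`K_S`. -/
theorem lfhtc_rational_identifiability
    {V : Type u} [Fintype V] [DecidableEq V]
    (DO : Finset (V × V)) (hDO : ∀ p ∈ DO, p.1 ≠ p.2)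
    (hacyc : ∀ v : V, ¬ Relation.TransGen (fun v w => (v, w) ∈ DO) v v)
    (Kf : V × V → Finset ℕ)
    (hKedge : ∀ p ∈ DO, (Kf p).Nonempty)
    (hKself : ∀ v : V, 0 ∉ Kf (v, v))
    (σ : GField V ≃+* GField V)
    (hσz : σ (gv (GVar.z : GVar V)) = (gv (GVar.z : GVar V))⁻¹)
    (hσφ : ∀ (v w : V) (k : ℕ), σ (gv (GVar.phi v w k)) = gv (GVar.phi v w k))
    (hσω : ∀ v : V, σ (gv (GVar.omega v)) = gv (GVar.omega v))
    (hσR : ∀ a : ℝ, σ (gconst a) = (gconst a : GField V))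
    (O L : Finset V) (hOL : Disjoint O L) (hcover : O ∪ L = Finset.univ)
    (hlat : ∀ l ∈ L, ∀ u : V, (u, l) ∉ DO)
    (v : V) (hv : v ∈ O)
    (Y W L' : Finset V)
    (hYO : Y ⊆ O) (hvY : v ∉ Y) (hWO : W ⊆ O) (hvW : v ∉ W) (hL' : L' ⊆ L)
    -- LF-HTC condition 1
    (htc1a : Y.card = (paO DO O v).card + L'.card)
    (htc1b : W.card = L'.card)
    (htc1c : Disjoint W (paO DO O v))
    -- LF-HTC condition 2
    (htc2a : Disjoint Y W)
    (htc2b : ∀ l : V, l ∈ Y.biUnion (paL DO L) →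
      l ∈ (insert v W).biUnion (paL DO L) → l ∈ L')
    -- LF-HTC condition 3: a system of latent-factor half-treks from Y to pa_O(v) ∪ W
    -- with no sided intersection in which every half-trek ending at some w ∈ W has the
    -- form y ← l → w with l ∈ L'
    (htc3 : ∃ ys ts : Fin Y.card → V,
      Function.Injective ys ∧ (∀ i, ys i ∈ Y) ∧
      Function.Injective ts ∧ (∀ i, ts i ∈ paO DO O v ∪ W) ∧
      ∃ T : TrekSystem (fun a b => (a, b) ∈ DO) Y.card ys ts,
        (∀ i, IsLFHT (↑O) (↑L) (T.trek i)) ∧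
        ∀ i, ts (T.perm i) ∈ W →
          (T.trek i).left.verts.length = 2 ∧ (T.trek i).right.verts.length = 2 ∧
            (T.trek i).top ∈ L')
    -- rational identifiability of the links into W ∪ (Y ∩ htr_{L'}(W ∪ {v}))
    (hid : ∀ y : V,
      (y ∈ W ∨ (y ∈ Y ∧ ∃ a ∈ insert v W,
        HtrReach (fun a b => (a, b) ∈ DO) (↑O) (↑L) L' a y)) →
      ∀ u ∈ O, (u, y) ∈ DO → Hmat DO Kf u y ∈ KS DO Kf σ O) :
    ∀ x ∈ O, (x, v) ∈ DO → Hmat DO Kf x v ∈ KS DO Kf σ O := by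
  classical
  obtain ⟨ρ, hρ'⟩ := exists_rank_of_acyclic _ hacyc
  have hρ : ∀ u w, (u, w) ∈ DO → ρ u < ρ w := hρ'
  obtain ⟨ys, ts, hys, hysY, hts, htsm, T, hT, hTW⟩ := htc3
  set t : Fin Y.card → V := fun i => ts (T.perm i) with ht
  have htinj : Function.Injective t := hts.comp T.perm.injective
  have htm : ∀ i, t i ∈ paO DO O v ∪ W := fun i => htsm _
  set K := KS DO Kf σ O with hK
  set N := Nmat DO Kf with hN
  set C := Cmat DO Kf L with hC
  set H := Hmat DO Kf with hH
  set d := dS Kf σ with hd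
  set R : V → Prop := fun y => ∃ a ∈ insert v W,
    HtrReach (fun a b => (a, b) ∈ DO) (↑O) (↑L) L' a y with hR
  set s : Fin Y.card → V := fun i => (T.trek i).left.first with hs
  have hsinj : Function.Injective s := by
    intro i j hij
    by_contra hne
    refine T.left_disj i j hne (s i) (T.trek i).left.first_mem ?_
    rw [hij]
    exact (T.trek j).left.first_mem
  set A : V → V → GField V := fun u y => if ¬ R y then N u y else C u y with hA
  set B : V → V → GField V := fun u y => if y ∉ W then N u y else C u y with hB
  set a : V → V → GField V := fun y u => ∑ x, A x y * d x * σ (N x u) with ha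
  set b : V → V → GField V := fun y u => ∑ x, A x y * d x * σ (C x u) with hb
  -- determinant
  have hdA : (Matrix.of fun j i => A (s j) (ys i)).det ≠ 0 := by
    have h := key_det DO hDO ρ hρ Kf hKedge O L hOL (fun i => (T.trek i).left) T.left_disj
      (fun i => ¬ R (ys i)) (by
        intro i _
        refine ⟨?_, ?_⟩
        · rw [T.left_last]; exact hYO (hysY i)
        · rcases hT i with h | h
          · exact Or.inl h.1
          · exact Or.inr ⟨h.1, h.2.1⟩)
    simp only [T.left_last] at h
    exact h
  have hdB : (Matrix.of fun j i => B (s j) (t i)).det ≠ 0 := by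
    have h := key_det DO hDO ρ hρ Kf hKedge O L hOL (fun i => (T.trek i).right) T.right_disj
      (fun i => t i ∉ W) (by
        intro i hi
        rw [not_not] at hi
        refine ⟨?_, ?_⟩
        · rw [T.right_last]; exact hWO hi
        · have h := hTW i hi
          refine Or.inr ⟨h.2.1, ?_⟩
          rw [← (T.trek i).top_eq]
          exact hL' h.2.2)
    simp only [T.right_last, ← (T.trek _).top_eq] at h
    exact h
  set M : Matrix (Fin Y.card) (Fin Y.card) (GField V) :=
    Matrix.of fun i k => ∑ u, A u (ys i) * d u * σ (B u (t k)) with hM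
  have hMdet : M.det ≠ 0 := by
    refine M_det_ne σ hσz hσφ Kf s hsinj (fun u i => A u (ys i)) (fun u i => B u (t i))
      ?_ ?_ hdA hdB
    · intro u i
      simp only [hA]
      split_ifs
      · exact spO_C s DO Kf L _ _
      · exact spO_N s DO Kf ρ hρ _ _
    · intro u i
      simp only [hB]
      split_ifs
      · exact spO_sigC σ hσz hσφ s DO Kf L _ _
      · exact spO_sigN σ hσz hσφ s DO Kf ρ hρ _ _
  have hM1 : ∀ i k, t k ∉ W → M i k = a (ys i) (t k) := by
    intro i k hk
    simp only [hM, hB, ha, Matrix.of_apply, hk, not_false_eq_true, if_true]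
  have hM2 : ∀ i k, t k ∈ W → M i k = b (ys i) (t k) := by
    intro i k hk
    simp only [hM, hB, hb, Matrix.of_apply, hk, not_true_eq_false, if_false]
  -- memberships
  have hσK : ∀ x ∈ K, σ x ∈ K := sig_KS σ hσz hσφ hσω hσR DO Kf ρ hρ O
  have hS : ∀ o ∈ O, ∀ o' ∈ O, Smat DO Kf σ o o' ∈ K := fun o ho o' ho' =>
    Subfield.subset_closure (Or.inr ⟨o, ho, o', ho', rfl⟩)
  have hHmem : ∀ y, (y ∈ W ∨ (y ∈ Y ∧ R y)) → ∀ u ∈ O, H u y ∈ K := by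
    intro y hy u hu
    by_cases h : (u, y) ∈ DO
    · exact hid y hy u hu h
    · have : H u y = 0 := by simp [hH, Hmat, h]
      rw [this]; exact zero_mem _
  have hCN : ∀ x y, C x y = N x y - ∑ u ∈ O, N x u * H u y :=
    fun x y => C_eq DO Kf ρ hρ O L hOL hcover hlat x y
  have hba : ∀ y w, b y w = a y w - ∑ u ∈ O, a y u * σ (H u w) := by
    intro y w
    simp only [hb, ha, hCN, map_sub, map_sum, map_mul, mul_sub, Finset.sum_sub_distrib,
      Finset.mul_sum, Finset.sum_mul]
    congr 1
    rw [Finset.sum_comm]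
    refine Finset.sum_congr rfl fun u _ => Finset.sum_congr rfl fun x _ => ?_
    ring
  have hamem : ∀ y ∈ Y, ∀ u ∈ O, a y u ∈ K := by
    intro y hy u hu
    by_cases hRy : R y
    · have : a y u = Smat DO Kf σ y u - ∑ u' ∈ O, H u' y * Smat DO Kf σ u' u := by
        simp only [ha, hA, hRy, not_true_eq_false, if_false, hCN, S_eq DO Kf σ ρ hρ,
          sub_mul, Finset.sum_sub_distrib, Finset.sum_mul, Finset.mul_sum]
        congr 1
        rw [Finset.sum_comm]
        refine Finset.sum_congr rfl fun u _ => Finset.sum_congr rfl fun x _ => ?_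
        ring
      rw [this]
      exact sub_mem (hS _ (hYO hy) _ hu) (sum_mem fun u' hu' =>
        mul_mem (hHmem y (Or.inr ⟨hy, hRy⟩) u' hu') (hS _ hu' _ hu))
    · have : a y u = Smat DO Kf σ y u := by
        simp only [ha, hA, hRy, not_false_eq_true, if_true, S_eq DO Kf σ ρ hρ]
        rfl
      rw [this]
      exact hS _ (hYO hy) _ hu
  have hbmem : ∀ y ∈ Y, ∀ w ∈ W, b y w ∈ K := by
    intro y hy w hw
    rw [hba]
    exact sub_mem (hamem y hy w (hWO hw)) (sum_mem fun u hu =>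
      mul_mem (hamem y hy u hu) (hσK _ (hHmem w (Or.inl hw) u hu)))
  have hpaO : paO DO O v ⊆ O := by
    intro x hx; simp only [paO, Finset.mem_filter] at hx; exact hx.2.2
  have hMmem : ∀ i k, M i k ∈ K := by
    intro i k
    by_cases hk : t k ∈ W
    · rw [hM2 i k hk]; exact hbmem _ (hysY i) _ hk
    · rw [hM1 i k hk]
      refine hamem _ (hysY i) _ (hpaO ?_)
      exact (Finset.mem_union.mp (htm k)).resolve_right hk
  -- factorisation through L'
  have hCsupp : ∀ x y, C x y ≠ 0 → x = y ∨ (x ∈ L ∧ (x, y) ∈ DO) := by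
    intro x y h
    by_cases hxy : x = y
    · exact Or.inl hxy
    · right
      rw [hC, Cmat, if_neg hxy, zero_add] at h
      have hsL : x ∈ L := by by_contra h'; exact h (if_neg h')
      rw [if_pos hsL] at h
      exact ⟨hsL, by by_contra h'; exact h (by simp [Hmat, h'])⟩
  have hvWO : ∀ w ∈ insert v W, w ∈ O := by
    intro w hw
    rcases Finset.mem_insert.mp hw with rfl | h
    · exact hv
    · exact hWO h
  have hYvW : ∀ y ∈ Y, y ∉ insert v W := by
    intro y hy h
    rcases Finset.mem_insert.mp h with rfl | h
    · exact hvY hy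
    · exact Finset.disjoint_left.mp htc2a hy h
  have hOnL : ∀ x ∈ O, x ∉ L := fun x hx => Finset.disjoint_left.mp hOL hx
  have hfac : ∀ y ∈ Y, ∀ w ∈ insert v W,
      b y w = ∑ l ∈ L', A l y * d l * σ (C l w) := by
    intro y hy w hw
    symm
    apply Finset.sum_subset (Finset.subset_univ _)
    intro x _ hx
    by_cases hCw : C x w = 0
    · rw [hCw, map_zero, mul_zero]
    · have hA0 : A x y = 0 := by
        by_cases hRy : R y
        · simp only [hA, hRy, not_true_eq_false, if_false]
          by_contra hCy
          rcases hCsupp _ _ hCw with rfl | ⟨h1, h2⟩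
          · rcases hCsupp _ _ hCy with rfl | ⟨h3, h4⟩
            · exact hYvW _ hy hw
            · exact hOnL _ (hvWO _ hw) h3
          · rcases hCsupp _ _ hCy with rfl | ⟨h3, h4⟩
            · exact hOnL _ (hYO hy) h1
            · refine hx (htc2b x ?_ ?_)
              · exact Finset.mem_biUnion.mpr ⟨y, hy, by simp [paL, h4, h3]⟩
              · exact Finset.mem_biUnion.mpr ⟨w, hw, by simp [paL, h2, h1]⟩
        · simp only [hA, hRy, not_false_eq_true, if_true]
          exact vanish DO Kf ρ hρ O L hOL hcover hlat L' hL' y w x (hYO hy) (hvWO w hw) hx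
            (fun h => hRy ⟨w, hw, h⟩) hCw
      rw [hA0, zero_mul, zero_mul]
  -- reindexing
  have himg : Finset.univ.image t = paO DO O v ∪ W := by
    apply Finset.eq_of_subset_of_card_le
    · intro x hx
      obtain ⟨i, _, rfl⟩ := Finset.mem_image.mp hx
      exact htm i
    · rw [Finset.card_image_of_injective _ htinj, Finset.card_univ, Fintype.card_fin,
        Finset.card_union_of_disjoint htc1c.symm, htc1a, htc1b]
  have hMz : ∀ (z : V → GField V) i, (M *ᵥ fun k => z (t k)) i =
      ∑ p ∈ paO DO O v, a (ys i) p * z p + ∑ w ∈ W, b (ys i) w * z w := by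
    intro z i
    have h1 : (M *ᵥ fun k => z (t k)) i = ∑ k, (fun u => (if u ∈ W then b (ys i) u
        else a (ys i) u) * z u) (t k) := by
      simp only [Matrix.mulVec, dotProduct]
      refine Finset.sum_congr rfl fun k _ => ?_
      by_cases hk : t k ∈ W
      · rw [hM2 i k hk, if_pos hk]
      · rw [hM1 i k hk, if_neg hk]
    rw [h1, ← Finset.sum_image (s := Finset.univ) (g := t)
      (f := fun u => (if u ∈ W then b (ys i) u else a (ys i) u) * z u) (fun x _ y _ h => htinj h), himg,
      Finset.sum_union htc1c.symm]
    congr 1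
    · refine Finset.sum_congr rfl fun p hp => ?_
      rw [if_neg (Finset.disjoint_right.mp htc1c hp)]
    · refine Finset.sum_congr rfl fun p hp => ?_
      rw [if_pos hp]
  have hbz : ∀ (z : V → GField V), ∀ y ∈ Y, ∑ w ∈ W, b y w * z w =
      ∑ l ∈ L', A l y * d l * ∑ w ∈ W, σ (C l w) * z w := by
    intro z y hy
    simp only [Finset.mul_sum]
    rw [Finset.sum_comm]
    refine Finset.sum_congr rfl fun w hw => ?_
    rw [hfac y hy w (Finset.mem_insert_of_mem hw), Finset.sum_mul]
    refine Finset.sum_congr rfl fun l _ => ?_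
    ring
  have hMinj : Function.Injective M.mulVec :=
    Matrix.mulVec_injective_iff_isUnit.mpr
      ((Matrix.isUnit_iff_isUnit_det _).mpr (isUnit_iff_ne_zero.mpr hMdet))
  have hψ : ∃ ψ : V → GField V, ∀ l ∈ L', ∑ w ∈ W, σ (C l w) * ψ w = σ (C l v) := by
    set Q : Matrix L' W (GField V) := Matrix.of fun l w => σ (C l.1 w.1) with hQ
    set ext : (W → GField V) → V → GField V :=
      fun x u => if h : u ∈ W then x ⟨u, h⟩ else 0 with hext
    have hQx : ∀ (x : W → GField V) (l : L'), (Q *ᵥ x) l =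
        ∑ w ∈ W, σ (C l.1 w) * ext x w := by
      intro x l
      rw [← Finset.sum_coe_sort W]
      simp only [Matrix.mulVec, dotProduct, hQ, Matrix.of_apply, hext, Finset.coe_mem,
        dif_pos]
    have hinj : Function.Injective Q.mulVecLin := by
      rw [injective_iff_map_eq_zero]
      intro x hx
      have h0 : (fun k => ext x (t k)) = 0 := by
        apply hMinj
        change M *ᵥ _ = M *ᵥ 0
        rw [Matrix.mulVec_zero]
        funext i
        rw [hMz, hbz _ _ (hysY i), Finset.sum_eq_zero, Finset.sum_eq_zero, add_zero]
        · rfl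
        · intro l hl
          rw [← hQx x ⟨l, hl⟩]
          have := congrFun hx ⟨l, hl⟩
          rw [Matrix.mulVecLin_apply] at this
          rw [this]; simp
        · intro p hp
          have : p ∉ W := Finset.disjoint_right.mp htc1c hp
          simp [hext, this]
      funext w
      have hw : w.1 ∈ Finset.univ.image t := by
        rw [himg]; exact Finset.mem_union_right _ w.2
      obtain ⟨k, _, hk⟩ := Finset.mem_image.mp hw
      have := congrFun h0 k
      simpa [hk, hext] using this
    have hsurj : Function.Surjective Q.mulVecLin :=
      (LinearMap.injective_iff_surjective_of_finrank_eq_finrank (by simp [htc1b])).mp hinj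
    obtain ⟨x, hx⟩ := hsurj (fun l => σ (C l.1 v))
    refine ⟨ext x, fun l hl => ?_⟩
    rw [← hQx x ⟨l, hl⟩]
    exact congrFun hx ⟨l, hl⟩
  obtain ⟨ψ, hψ⟩ := hψ
  set z : V → GField V := fun u => if u ∈ W then ψ u else σ (H u v) with hz
  have hsol : M *ᵥ (fun k => z (t k)) = fun i => a (ys i) v := by
    funext i
    rw [hMz, hbz _ _ (hysY i)]
    have h1 : ∑ p ∈ paO DO O v, a (ys i) p * z p = ∑ u ∈ O, a (ys i) u * σ (H u v) := by
      rw [← Finset.sum_subset hpaO (f := fun u => a (ys i) u * σ (H u v))]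
      · refine Finset.sum_congr rfl fun p hp => ?_
        simp only [hz, if_neg (Finset.disjoint_right.mp htc1c hp)]
      · intro u hu hu'
        have : (u, v) ∉ DO := fun h => hu' (by simp [paO, h, hu])
        simp [hH, Hmat, this]
    have h2 : ∑ l ∈ L', A l (ys i) * d l * ∑ w ∈ W, σ (C l w) * z w = b (ys i) v := by
      rw [hfac _ (hysY i) v (Finset.mem_insert_self _ _)]
      refine Finset.sum_congr rfl fun l hl => ?_
      rw [← hψ l hl]
      congr 1
      refine Finset.sum_congr rfl fun w hw => ?_
      simp only [hz, if_pos hw]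
    rw [h1, h2, hba]
    ring
  intro x hx hxv
  have hxpa : x ∈ paO DO O v := by simp [paO, hxv, hx]
  have hxi : x ∈ Finset.univ.image t := by
    rw [himg]; exact Finset.mem_union_left _ hxpa
  obtain ⟨k, _, hk⟩ := Finset.mem_image.mp hxi
  have hmem := solve_mem K M _ _ hMmem (fun i => hamem _ (hysY i) v hv) hMdet hsol k
  rw [hk] at hmem
  simp only [hz, if_neg (Finset.disjoint_right.mp htc1c hxpa)] at hmem
  have := hσK _ hmem
  rwa [hH, sig_sig_H σ hσz hσφ] at this
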